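/- Case 6 of Theorem 1.2: the hypergeometric group Γ(f,g) generated by the companion matrices A and B of f(x) = x^5 + x^4 + x^3 - x^2 - x - 1 and g(x) = x^5 + x^3 + x^2 + 1 is an arithmetic subgroup of the integral orthogonal group O_Q(ℤ): Γ(f,g) is contained in O_Q(ℤ) (in particular Aᵀ·Q·A = Q and Bᵀ·Q·B = Q), and Γ(f,g) has finite index in O_Q(ℤ). -/

import Mathlib

open Matrix

/-- The companion matrix `A` of `f(x) = x^5 + x^4 + x^3 - x^2 - x - 1`. -/
def matA : Matrix (Fin 5) (Fin 5) ℤ :=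
  !![(0 : ℤ), 0, 0, 0, 1; 1, 0, 0, 0, 1; 0, 1, 0, 0, 1; 0, 0, 1, 0, -1; 0, 0, 0, 1, -1]

/-- The companion matrix `B` of `g(x) = x^5 + x^3 + x^2 + 1`. -/
def matB : Matrix (Fin 5) (Fin 5) ℤ :=
  !![(0 : ℤ), 0, 0, 0, -1; 1, 0, 0, 0, 0; 0, 1, 0, 0, -1; 0, 0, 1, 0, -1; 0, 0, 0, 1, 0]

/-- The symmetric integer matrix `Q` of the quadratic form preserved by `Γ(f,g)`. -/
def matQ : Matrix (Fin 5) (Fin 5) ℤ :=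
  !![(1 : ℤ), 0, -2, 1, 2; 0, 1, 0, -2, 1; -2, 0, 1, 0, -2; 1, -2, 0, 1, 0; 2, 1, -2, 0, 1]

/-- The integral orthogonal group `O_Q(ℤ)` of a matrix `Q`, as the subgroup of `GL₅(ℤ)`
consisting of all `M` with `Mᵀ * Q * M = Q`. -/
def orthogonalSubgroup (Q : Matrix (Fin 5) (Fin 5) ℤ) : Subgroup (GL (Fin 5) ℤ) where
  carrier := { M : GL (Fin 5) ℤ |
      (M : Matrix (Fin 5) (Fin 5) ℤ)ᵀ * Q * (M : Matrix (Fin 5) (Fin 5) ℤ) = Q }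
  one_mem' := by simp
  mul_mem' := by
    intro a b ha hb
    simp only [Set.mem_setOf_eq, Units.val_mul, transpose_mul] at ha hb ⊢
    calc ((b : Matrix (Fin 5) (Fin 5) ℤ)ᵀ * (a : Matrix (Fin 5) (Fin 5) ℤ)ᵀ) * Q *
          ((a : Matrix (Fin 5) (Fin 5) ℤ) * (b : Matrix (Fin 5) (Fin 5) ℤ))
        = (b : Matrix (Fin 5) (Fin 5) ℤ)ᵀ *
            ((a : Matrix (Fin 5) (Fin 5) ℤ)ᵀ * Q * (a : Matrix (Fin 5) (Fin 5) ℤ)) *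
            (b : Matrix (Fin 5) (Fin 5) ℤ) := by
          simp only [mul_assoc]
      _ = Q := by rw [ha, hb]
  inv_mem' := by
    intro a ha
    simp only [Set.mem_setOf_eq] at ha ⊢
    calc ((a⁻¹ : GL (Fin 5) ℤ) : Matrix (Fin 5) (Fin 5) ℤ)ᵀ * Q *
          ((a⁻¹ : GL (Fin 5) ℤ) : Matrix (Fin 5) (Fin 5) ℤ)
        = ((a⁻¹ : GL (Fin 5) ℤ) : Matrix (Fin 5) (Fin 5) ℤ)ᵀ *
            ((a : Matrix (Fin 5) (Fin 5) ℤ)ᵀ * Q * (a : Matrix (Fin 5) (Fin 5) ℤ)) *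
            ((a⁻¹ : GL (Fin 5) ℤ) : Matrix (Fin 5) (Fin 5) ℤ) := by rw [ha]
      _ = ((a : Matrix (Fin 5) (Fin 5) ℤ) *
            ((a⁻¹ : GL (Fin 5) ℤ) : Matrix (Fin 5) (Fin 5) ℤ))ᵀ * Q *
          ((a : Matrix (Fin 5) (Fin 5) ℤ) *
            ((a⁻¹ : GL (Fin 5) ℤ) : Matrix (Fin 5) (Fin 5) ℤ)) := by
          simp only [transpose_mul, mul_assoc]
      _ = Q := by rw [Units.mul_inv]; simp

/-- `FC H K`: `K` is covered by finitely many left translates of `H`. -/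
def FC {G : Type*} [Group G] (H K : Subgroup G) : Prop :=
  ∃ F : Set G, F.Finite ∧ ∀ x ∈ K, ∃ f ∈ F, ∃ h ∈ H, x = f * h

lemma FC.trans {G : Type*} [Group G] {H K L : Subgroup G} (h1 : FC H K) (h2 : FC K L) :
    FC H L := by
  obtain ⟨F, hF, h1⟩ := h1
  obtain ⟨F', hF', h2⟩ := h2
  refine ⟨Set.image2 (fun a b => a * b) F' F, hF'.image2 _ hF, ?_⟩
  intro x hx
  obtain ⟨f, hf, k, hk, rfl⟩ := h2 x hx
  obtain ⟨f', hf', h, hh, rfl⟩ := h1 k hk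
  exact ⟨f * f', ⟨f, hf, f', hf', rfl⟩, h, hh, by group⟩

lemma FC.mono {G : Type*} [Group G] {H H' K : Subgroup G} (h1 : FC H K) (h2 : H ≤ H') :
    FC H' K := by
  obtain ⟨F, hF, h1⟩ := h1
  refine ⟨F, hF, fun x hx => ?_⟩
  obtain ⟨f, hf, k, hk, e⟩ := h1 x hx
  exact ⟨f, hf, k, h2 hk, e⟩

lemma FC_refl {G : Type*} [Group G] (H : Subgroup G) : FC H H :=
  ⟨{1}, Set.finite_singleton _, fun x hx => ⟨1, rfl, x, hx, by simp⟩⟩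

lemma FC_step {G : Type*} [Group G] (S : Set G) (c : G) (n : ℕ) (hn : 0 < n) (hc : c ^ n = 1)
    (hs : ∀ s ∈ S, c * s * c⁻¹ ∈ Subgroup.closure S) :
    FC (Subgroup.closure S) (Subgroup.closure (insert c S)) := by
  have conj : ∀ h ∈ Subgroup.closure S, c * h * c⁻¹ ∈ Subgroup.closure S := by
    intro h hh
    induction hh using Subgroup.closure_induction with
    | mem x hx => exact hs x hx
    | one => simp
    | mul x y _ _ hx hy =>
      have := mul_mem hx hy
      convert this using 1
      group
    | inv x _ hx =>
      have := inv_mem hx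
      convert this using 1
      group
  have conjk : ∀ k : ℕ, ∀ h ∈ Subgroup.closure S,
      c ^ k * h * (c ^ k)⁻¹ ∈ Subgroup.closure S := by
    intro k
    induction k with
    | zero => intro h hh; simpa using hh
    | succ k ih =>
      intro h hh
      have := conj _ (ih h hh)
      convert this using 1
      rw [pow_succ']
      group
  have hinv : ∀ i : ℕ, (c ^ i)⁻¹ = c ^ ((n - 1) * i) := by
    intro i
    rw [inv_eq_iff_mul_eq_one, ← pow_add]
    have : i + (n - 1) * i = n * i := by
      obtain ⟨m, rfl⟩ : ∃ m, n = m + 1 := ⟨n - 1, by omega⟩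
      simp only [Nat.add_sub_cancel]
      ring
    rw [this, pow_mul, hc, one_pow]
  have main : ∀ x ∈ Subgroup.closure (insert c S), ∃ i : ℕ, ∃ h ∈ Subgroup.closure S,
      x = c ^ i * h := by
    intro x hx
    induction hx using Subgroup.closure_induction with
    | mem x hx =>
      rcases hx with rfl | hx
      · exact ⟨1, 1, one_mem _, by simp⟩
      · exact ⟨0, x, Subgroup.subset_closure hx, by simp⟩
    | one => exact ⟨0, 1, one_mem _, by simp⟩
    | mul x y _ _ hx hy =>
      obtain ⟨i, h, hh, rfl⟩ := hx
      obtain ⟨j, k, hk, rfl⟩ := hy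
      refine ⟨i + j, (c ^ j)⁻¹ * h * c ^ j * k, mul_mem ?_ hk, by rw [pow_add]; group⟩
      have := conjk ((n - 1) * j) h hh
      rwa [← hinv, inv_inv] at this
    | inv x _ hx =>
      obtain ⟨i, h, hh, rfl⟩ := hx
      refine ⟨(n - 1) * i, c ^ i * h⁻¹ * (c ^ i)⁻¹, conjk i _ (inv_mem hh), ?_⟩
      rw [← hinv]
      group
  refine ⟨(fun i => c ^ i) '' Set.Iio n, (Set.finite_Iio n).image _, fun x hx => ?_⟩
  obtain ⟨i, h, hh, rfl⟩ := main x hx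
  refine ⟨c ^ (i % n), ⟨i % n, Nat.mod_lt _ hn, rfl⟩, h, hh, ?_⟩
  rw [← pow_mod_orderOf, ← pow_mod_orderOf c (i % n),
    Nat.mod_mod_of_dvd _ (orderOf_dvd_of_pow_eq_one hc)]

lemma FC.finiteIndex {G : Type*} [Group G] {H K : Subgroup G} (h : FC H K) :
    (H.subgroupOf K).FiniteIndex := by
  obtain ⟨F, hF, h⟩ := h
  have key : ∀ x : K, ∃ f : F, ∃ k ∈ H, (x : G) = f * k := by
    intro x
    obtain ⟨f, hf, k, hk, e⟩ := h x x.2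
    exact ⟨⟨f, hf⟩, k, hk, e⟩
  choose φ k hk e using key
  have := hF.to_subtype
  have hfin : Finite (K ⧸ H.subgroupOf K) := by
    refine Finite.of_injective (fun q : K ⧸ H.subgroupOf K => φ q.out) ?_
    intro p q hpq
    rw [← p.out_eq', ← q.out_eq']
    simp only at hpq
    apply Quotient.sound'
    rw [QuotientGroup.leftRel_apply, Subgroup.mem_subgroupOf]
    have h1 := e p.out
    have h2 := e q.out
    push_cast
    rw [h1, h2, hpq]
    have : ((φ (Quotient.out q) : G) * k (Quotient.out p))⁻¹ *
      ((φ (Quotient.out q) : G) * k (Quotient.out q)) =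
        (k (Quotient.out p))⁻¹ * k (Quotient.out q) := by group
    rw [this]
    exact mul_mem (inv_mem (hk _)) (hk _)
  exact Subgroup.finiteIndex_of_finite_quotient

def gm : Fin 17 → Matrix (Fin 5) (Fin 5) ℤ :=
  ![
    !![1, 0, -3, 0, 3; 0, 1, -2, 0, 2; 0, 0, -1, 0, 2; 0, 0, -1, 1, 1; 0, 0, 0, 0, 1],
    !![1, 0, 0, 0, 0; 0, 1, 0, -3, 0; 0, 0, 1, -2, 0; 0, 0, 0, -1, 0; 0, 0, 0, -1, 1],
    !![1, 0, 0, 0, 1; 0, 1, 0, 0, 0; 0, 0, 1, 0, -2; 0, 0, 0, 1, -1; 0, 0, 0, 0, -1],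
    !![-1, 0, 0, 0, 0; -1, 1, 0, 0, 0; -2, 0, 1, 0, 0; 0, 0, 0, 1, 0; 1, 0, 0, 0, 1],
    !![1, -4, -4, 4, 4; 0, 0, -1, 1, 1; 0, -2, -1, 2, 2; 0, -2, -2, 3, 2; 0, 1, 1, -1, 0],
    !![2, 0, -1, -1, 1; 4, 1, -4, -4, 4; 2, 0, -1, -2, 2; 3, 0, -3, -2, 3; 2, 0, -2, -2, 3],
    !![1, 0, -1, 0, 0; 0, 1, -1, 0, 0; 0, 0, -1, 0, 0; 0, 0, -1, 1, 0; 0, 0, -1, 0, 1],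
    !![0, 0, 0, 1, 0; 1, 1, 0, -1, 0; 0, 0, 1, 0, 0; 1, 0, 0, 0, 0; 1, 0, 0, -1, 1],
    !![1, -1, 0, 0, 1; 0, 0, 0, 0, 1; 0, 0, 1, 0, 0; 0, -1, 0, 1, 1; 0, 1, 0, 0, 0],
    !![0, -1, 1, 3, -3; -4, -3, 4, 12, -12; 0, 0, 1, 0, 0; -1, -1, 1, 4, -3; 0, 0, 0, 0, 1],
    !![0, 1, 1, -1, -1; 0, 1, 0, 0, 0; 0, 0, 1, 0, 0; -1, 1, 1, 0, -1; 0, 0, 0, 0, 1],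
    !![1, 0, 0, 0, 0; 0, -1, 0, 4, -2; 0, 0, 1, 0, 0; 0, 0, 0, 1, 0; 0, 0, 0, 0, 1],
    !![-1, 0, 4, -2, -4; 0, 1, 0, 0, 0; 0, 0, 1, 0, 0; 0, 0, 0, 1, 0; 0, 0, 0, 0, 1],
    !![1, 0, 0, 0, 0; 0, 1, 0, 0, 0; 4, 0, -1, 0, 4; 0, 0, 0, 1, 0; 0, 0, 0, 0, 1],
    !![1, 0, 0, 0, 0; 1, 0, 0, -1, 1; 1, 0, 0, -1, 0; 1, -1, 0, 0, 1; 1, 0, -1, -1, 1],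
    !![1, 0, 0, 0, 0; 1, 1, -1, -1, 0; 1, 0, 0, -1, 0; 1, 0, -1, 0, 0; 1, 0, -1, -1, 1],
    !![0, 1, 2, -3, -1; 1, 0, -2, 3, 1; 0, 0, 1, 0, 0; 0, 0, 0, 1, 0; 0, 0, 0, 0, 1]]

def tab6 : List (List (Fin 17)) :=
  [[2],
   [0, 1, 2, 1, 0],
   [0],
   [5, 1, 2, 1, 5],
   [5, 4, 1, 3, 2, 3, 1, 4, 5],
   [1, 2, 3, 2, 1]]

def tab7 : List (List (Fin 17)) :=
  [[5],
   [3],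
   [6, 5, 6],
   [1],
   [2, 5, 6, 4, 6, 5, 2],
   [0],
   [6]]

def tab8 : List (List (Fin 17)) :=
  [[6, 4, 1, 0, 1, 4, 6],
   [6, 4, 6],
   [4, 0, 1, 0, 4],
   [6, 7, 4, 7, 6],
   [6, 1, 6],
   [4, 5, 6, 1, 6, 5, 4],
   [6],
   [7]]

def tab9 : List (List (Fin 17)) :=
  [[0],
   [5, 8, 7, 4, 0, 4, 7, 8, 5],
   [2],
   [0, 8, 4, 0, 4, 8, 0],
   [6, 1, 2, 8, 5, 1, 5, 8, 2, 1, 6],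
   [5],
   [6],
   [7],
   [1, 2, 8, 5, 1, 8, 1, 5, 8, 2, 1]]

def tab10 : List (List (Fin 17)) :=
  [[0],
   [7, 4, 7],
   [2],
   [4],
   [3],
   [5],
   [6],
   [7],
   [8],
   [4, 3, 9, 3, 4]]

def tab11 : List (List (Fin 17)) :=
  [[0],
   [1],
   [2],
   [3],
   [9, 3, 9],
   [5],
   [6],
   [7],
   [1, 2, 1, 8, 1, 2, 1],
   [10],
   [9]]

def tab12 : List (List (Fin 17)) :=
  [[0],
   [1],
   [2],
   [0, 1, 5, 1, 0],
   [4],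
   [1, 0, 3, 0, 1],
   [6],
   [0, 1, 0, 7, 0, 1, 0],
   [8],
   [1, 6, 1, 10, 1, 6, 1],
   [1, 6, 1, 9, 1, 6, 1],
   [11]]

def tab13 : List (List (Fin 17)) :=
  [[3, 6, 0, 3, 0, 6, 3],
   [1],
   [2],
   [3],
   [1, 3, 9, 3, 9, 3, 1],
   [2, 3, 1, 0, 1, 3, 2],
   [2, 3, 0, 6, 0, 3, 2],
   [7],
   [8],
   [1, 3, 10, 3, 1],
   [1, 3, 9, 3, 1],
   [11],
   [7, 2, 3, 12, 3, 2, 7]]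

def tab14 : List (List (Fin 17)) :=
  [[0],
   [6, 3, 6],
   [8, 0, 8],
   [3],
   [4],
   [2],
   [8],
   [6],
   [7],
   [10, 12, 10, 12, 10],
   [10],
   [10, 12, 10],
   [6, 13, 6],
   [8, 10, 11, 10, 8]]

def tab15 : List (List (Fin 17)) :=
  [[0],
   [6, 3, 6],
   [5],
   [3],
   [4],
   [2],
   [7],
   [6],
   [8],
   [9],
   [10],
   [11],
   [6, 13, 6],
   [7, 12, 7],
   [14, 14]]

def tab16 : List (List (Fin 17)) :=
  [[0],
   [1],
   [2],
   [6, 1, 4, 1, 6],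
   [1, 6, 3, 6, 1],
   [1, 2, 4, 2, 1],
   [6],
   [1, 4, 8, 4, 1],
   [2, 1, 0, 7, 0, 1, 2],
   [9],
   [12, 9, 12],
   [12],
   [11],
   [0, 9, 13, 9, 0],
   [1, 6, 15, 14, 6, 1, 2, 12, 15, 12, 2],
   [1, 6, 15, 14, 6, 1]]

/-- Words expressing the conjugates of the earlier generators by the `n`-th one. -/
def tab : Fin 17 → List (List (Fin 17)) :=
  ![[], [], [], [], [], [], tab6, tab7, tab8, tab9, tab10, tab11, tab12, tab13, tab14, tab15, tab16]

/-- The inverses of the generators. -/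
def giv (i : Fin 17) : Matrix (Fin 5) (Fin 5) ℤ := if i = 14 then gm 14 * gm 14 else gm i

set_option maxRecDepth 100000 in
lemma gm_giv : ∀ i, gm i * giv i = 1 := by decide +kernel

set_option maxRecDepth 100000 in
lemma giv_gm : ∀ i, giv i * gm i = 1 := by decide +kernel

/-- The generators of the large group, as elements of `GL₅(ℤ)`. -/
def gG (i : Fin 17) : GL (Fin 5) ℤ := ⟨gm i, giv i, gm_giv i, giv_gm i⟩

lemma gG_val (i : Fin 17) : (gG i : Matrix (Fin 5) (Fin 5) ℤ) = gm i := rfl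

set_option maxRecDepth 100000 in
lemma gm_six : ∀ i, gm i ^ 6 = 1 := by decide +kernel

set_option maxRecDepth 100000 in
lemma tab_check : ∀ n : Fin 17, 6 ≤ n.val → ∀ j : Fin 17, j.val < n.val →
    (∀ i ∈ (tab n).getD j.val [], i.val < n.val) ∧
    (((tab n).getD j.val []).map gm).prod * gm n = gm n * gm j := by decide +kernel

/-- The subgroup generated by the first `n` generators. -/
def gH (n : ℕ) : Subgroup (GL (Fin 5) ℤ) := Subgroup.closure (gG '' {i | i.val < n})

lemma gG_mem {n : ℕ} {i : Fin 17} (h : i.val < n) : gG i ∈ gH n :=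
  Subgroup.subset_closure ⟨i, h, rfl⟩

lemma word_val (l : List (Fin 17)) :
    ((l.map gG).prod : GL (Fin 5) ℤ).val = (l.map gm).prod := by
  induction l with
  | nil => simp
  | cons a l ih => simp [ih, gG_val]

lemma gH_step (n : ℕ) (h6 : 6 ≤ n) (hn : n < 17) : FC (gH n) (gH (n + 1)) := by
  have hset : gG '' {i : Fin 17 | i.val < n + 1} =
      insert (gG ⟨n, hn⟩) (gG '' {i | i.val < n}) := by
    rw [← Set.image_insert_eq]
    congr 1
    ext i
    simp only [Set.mem_setOf_eq, Set.mem_insert_iff, Fin.ext_iff]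
    omega
  unfold gH
  rw [hset]
  apply FC_step _ _ 6 (by norm_num)
  · apply Units.ext
    rw [Units.val_pow_eq_pow_val, gG_val, gm_six]
    rfl
  · rintro _ ⟨j, hj, rfl⟩
    obtain ⟨h1, h2⟩ := tab_check ⟨n, hn⟩ h6 j hj
    have : gG ⟨n, hn⟩ * gG j * (gG ⟨n, hn⟩)⁻¹ =
        (((tab ⟨n, hn⟩).getD j.val []).map gG).prod := by
      rw [mul_inv_eq_iff_eq_mul]
      apply Units.ext
      rw [Units.val_mul, Units.val_mul, word_val, gG_val, gG_val, h2]
    rw [this]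
    apply Subgroup.list_prod_mem
    intro x hx
    obtain ⟨i, hi, rfl⟩ := List.mem_map.1 hx
    exact gG_mem (h1 i hi)

lemma gH_FC : FC (gH 6) (gH 17) := by
  have : ∀ n, 6 ≤ n → n ≤ 17 → FC (gH 6) (gH n) := by
    intro n h
    induction n, h using Nat.le_induction with
    | base => intro _; exact FC_refl _
    | succ n hn ih => intro h; exact (ih (by omega)).trans (gH_step n hn (by omega))
  exact this 17 (by norm_num) le_rfl

/-- Exponents realizing the first six generators in `Γ(f,g)`. -/
def wexp : Fin 17 → ℕ := ![9, 10, 11, 0, 6, 7, 0, 0, 0, 0, 0, 0, 0, 0, 0, 0, 0]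

set_option maxRecDepth 100000 in
lemma wexp_check : ∀ i : Fin 17, i.val < 6 →
    gm i * matB ^ wexp i * matA = matB ^ (wexp i + 1) := by decide +kernel

lemma gH6_le (A B : GL (Fin 5) ℤ) (hA : (A : Matrix (Fin 5) (Fin 5) ℤ) = matA)
    (hB : (B : Matrix (Fin 5) (Fin 5) ℤ) = matB) : gH 6 ≤ Subgroup.closure {A, B} := by
  unfold gH
  rw [Subgroup.closure_le]
  rintro _ ⟨i, hi, rfl⟩
  have hAm : A ∈ Subgroup.closure {A, B} := Subgroup.subset_closure (by simp)
  have hBm : B ∈ Subgroup.closure {A, B} := Subgroup.subset_closure (by simp)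
  have : gG i = B ^ (wexp i + 1) * A⁻¹ * (B ^ wexp i)⁻¹ := by
    rw [eq_mul_inv_iff_mul_eq, eq_mul_inv_iff_mul_eq]
    apply Units.ext
    simp only [Units.val_mul, Units.val_pow_eq_pow_val, gG_val, hA, hB]
    exact wexp_check i hi
  rw [this]
  exact mul_mem (mul_mem (pow_mem hBm _) (inv_mem hAm)) (inv_mem (pow_mem hBm _))

set_option maxRecDepth 100000 in
lemma gm_orth : ∀ i, (gm i)ᵀ * matQ * gm i = matQ := by decide +kernel

lemma gH17_le : gH 17 ≤ orthogonalSubgroup matQ := by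
  unfold gH
  rw [Subgroup.closure_le]
  rintro _ ⟨i, _, rfl⟩
  exact gm_orth i

/-- The change of coordinates diagonalizing the form. -/
def matT : Matrix (Fin 5) (Fin 5) ℤ :=
  !![0, 0, -1, 2, 0; 0, 0, -1, 0, 2; 0, 0, 1, 0, 0; 1, 0, -2, 1, 2; 0, 1, 0, -2, 1]

/-- An element of `L` moves every vector with diagonal coordinates `u` to one with coordinates
`w`. -/
def Reach (L : Subgroup (GL (Fin 5) ℤ)) (u w : Fin 5 → ℤ) : Prop :=
  ∃ γ ∈ L, ∀ v : Fin 5 → ℤ, matT *ᵥ v = u →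
    matT *ᵥ ((γ : Matrix (Fin 5) (Fin 5) ℤ) *ᵥ v) = w

lemma Reach.trans {L : Subgroup (GL (Fin 5) ℤ)} {u w z : Fin 5 → ℤ} (h1 : Reach L u w)
    (h2 : Reach L w z) : Reach L u z := by
  obtain ⟨γ, hγ, h1⟩ := h1
  obtain ⟨δ, hδ, h2⟩ := h2
  refine ⟨δ * γ, mul_mem hδ hγ, fun v hv => ?_⟩
  rw [Units.val_mul, ← Matrix.mulVec_mulVec]
  exact h2 _ (h1 v hv)

lemma Reach.refl (L : Subgroup (GL (Fin 5) ℤ)) (u : Fin 5 → ℤ) : Reach L u u :=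
  ⟨1, one_mem _, fun v hv => by simpa using hv⟩

lemma reach_word {L : Subgroup (GL (Fin 5) ℤ)} (l : List (Fin 17)) (hl : ∀ i ∈ l, gG i ∈ L)
    (S : Matrix (Fin 5) (Fin 5) ℤ) (hS : matT * (l.map gm).prod = S * matT) (u w : Fin 5 → ℤ)
    (hw : S *ᵥ u = w) : Reach L u w := by
  refine ⟨(l.map gG).prod, ?_, ?_⟩
  · apply Subgroup.list_prod_mem
    intro x hx
    obtain ⟨i, hi, rfl⟩ := List.mem_map.1 hx
    exact hl i hi
  · intro v hv
    rw [word_val, Matrix.mulVec_mulVec, hS, ← Matrix.mulVec_mulVec, hv, hw]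

/-- The generators fixing the second basis vector which are used in the reduction. -/
def Good (L : Subgroup (GL (Fin 5) ℤ)) : Prop :=
  ∀ i ∈ ([0, 1, 2, 6, 7, 12, 15] : List (Fin 17)), gG i ∈ L

section moves
variable {L : Subgroup (GL (Fin 5) ℤ)}

lemma good_word (hL : Good L) (l : List (Fin 17))
    (h : ∀ i ∈ l, i ∈ ([0, 1, 2, 6, 7, 12, 15] : List (Fin 17))) : ∀ i ∈ l, gG i ∈ L :=
  fun i hi => hL i (h i hi)

lemma mv_e3 (hL : Good L) (a b c x y : ℤ) : Reach L ![a, b, c, x, y] ![a, b, -c, x, y] := by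
  refine reach_word [6] (good_word hL _ (by decide))
    !![1,0,0,0,0; 0,1,0,0,0; 0,0,-1,0,0; 0,0,0,1,0; 0,0,0,0,1] (by decide +kernel) _ _ ?_
  ext i; fin_cases i <;> simp [Matrix.mulVec, dotProduct, Fin.sum_univ_five]

lemma mv_f1 (hL : Good L) (a b c x y : ℤ) : Reach L ![a, b, c, x, y] ![a, b, c, -x, y] := by
  refine reach_word [12] (good_word hL _ (by decide))
    !![1,0,0,0,0; 0,1,0,0,0; 0,0,1,0,0; 0,0,0,-1,0; 0,0,0,0,1] (by decide +kernel) _ _ ?_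
  ext i; fin_cases i <;> simp [Matrix.mulVec, dotProduct, Fin.sum_univ_five]

lemma mv_p23 (hL : Good L) (a b c x y : ℤ) : Reach L ![a, b, c, x, y] ![a, c, b, x, y] := by
  refine reach_word [0] (good_word hL _ (by decide))
    !![1,0,0,0,0; 0,0,1,0,0; 0,1,0,0,0; 0,0,0,1,0; 0,0,0,0,1] (by decide +kernel) _ _ ?_
  ext i; fin_cases i <;> simp [Matrix.mulVec, dotProduct, Fin.sum_univ_five]

lemma mv_p12 (hL : Good L) (a b c x y : ℤ) : Reach L ![a, b, c, x, y] ![b, a, c, x, y] := by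
  refine reach_word [2, 1, 2] (good_word hL _ (by decide))
    !![0,1,0,0,0; 1,0,0,0,0; 0,0,1,0,0; 0,0,0,1,0; 0,0,0,0,1] (by decide +kernel) _ _ ?_
  ext i; fin_cases i <;> simp [Matrix.mulVec, dotProduct, Fin.sum_univ_five]

lemma mv_e2 (hL : Good L) (a b c x y : ℤ) : Reach L ![a, b, c, x, y] ![a, -b, c, x, y] :=
  (mv_p23 hL _ _ _ _ _).trans ((mv_e3 hL _ _ _ _ _).trans (mv_p23 hL _ _ _ _ _))

lemma mv_e1 (hL : Good L) (a b c x y : ℤ) : Reach L ![a, b, c, x, y] ![-a, b, c, x, y] :=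
  (mv_p12 hL _ _ _ _ _).trans ((mv_e2 hL _ _ _ _ _).trans (mv_p12 hL _ _ _ _ _))

lemma mv_P (hL : Good L) (a b c x y : ℤ) : Reach L ![a, b, c, x, y]
    ![a - 2 * (a + b - x), b - 2 * (a + b - x), c, x - 2 * (a + b - x), y] := by
  refine reach_word [7] (good_word hL _ (by decide))
    !![-1,-2,0,2,0; -2,-1,0,2,0; 0,0,1,0,0; -2,-2,0,3,0; 0,0,0,0,1] (by decide +kernel) _ _ ?_
  ext i; fin_cases i <;> simp [Matrix.mulVec, dotProduct, Fin.sum_univ_five] <;> ring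

lemma mv_t (hL : Good L) (a b c x y : ℤ) : Reach L ![a, b, c, x, y]
    ![a - (a + b + c - x), b - (a + b + c - x), c - (a + b + c - x), x - (a + b + c - x), y] := by
  refine reach_word [15] (good_word hL _ (by decide))
    !![0,-1,-1,1,0; -1,0,-1,1,0; -1,-1,0,1,0; -1,-1,-1,2,0; 0,0,0,0,1] (by decide +kernel) _ _ ?_
  ext i; fin_cases i <;> simp [Matrix.mulVec, dotProduct, Fin.sum_univ_five] <;> ring

lemma mv_f2 (hL : gG 11 ∈ L) (a b c x y : ℤ) :
    Reach L ![a, b, c, x, y] ![a, b, c, x, -y] := by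
  refine reach_word [11] (by simpa using hL)
    !![1,0,0,0,0; 0,1,0,0,0; 0,0,1,0,0; 0,0,0,1,0; 0,0,0,0,-1] (by decide +kernel) _ _ ?_
  ext i; fin_cases i <;> simp [Matrix.mulVec, dotProduct, Fin.sum_univ_five]

lemma mv_q (hL : gG 16 ∈ L) (a b c x y : ℤ) :
    Reach L ![a, b, c, x, y] ![a, b, c, y, x] := by
  refine reach_word [16] (by simpa using hL)
    !![1,0,0,0,0; 0,1,0,0,0; 0,0,1,0,0; 0,0,0,0,1; 0,0,0,1,0] (by decide +kernel) _ _ ?_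
  ext i; fin_cases i <;> simp [Matrix.mulVec, dotProduct, Fin.sum_univ_five]

lemma mv_M (hL : gG 9 ∈ L) (a b c x y : ℤ) : Reach L ![a, b, c, x, y]
    ![a + 2 * (a - x - y), b, c, x + 2 * (a - x - y), y + 2 * (a - x - y)] := by
  refine reach_word [9] (by simpa using hL)
    !![3,0,0,-2,-2; 0,1,0,0,0; 0,0,1,0,0; 2,0,0,-1,-2; 2,0,0,-2,-1] (by decide +kernel) _ _ ?_
  ext i; fin_cases i <;> simp [Matrix.mulVec, dotProduct, Fin.sum_univ_five] <;> ring

lemma nrm_abs (hL : Good L) (a b c x y : ℤ) :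
    Reach L ![a, b, c, x, y] ![|a|, |b|, |c|, |x|, y] := by
  have h1 : Reach L ![a, b, c, x, y] ![|a|, b, c, x, y] := by
    rcases abs_choice a with h | h <;> rw [h]
    exacts [Reach.refl _ _, mv_e1 hL _ _ _ _ _]
  have h2 : Reach L ![|a|, b, c, x, y] ![|a|, |b|, c, x, y] := by
    rcases abs_choice b with h | h <;> rw [h]
    exacts [Reach.refl _ _, mv_e2 hL _ _ _ _ _]
  have h3 : Reach L ![|a|, |b|, c, x, y] ![|a|, |b|, |c|, x, y] := by
    rcases abs_choice c with h | h <;> rw [h]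
    exacts [Reach.refl _ _, mv_e3 hL _ _ _ _ _]
  have h4 : Reach L ![|a|, |b|, |c|, x, y] ![|a|, |b|, |c|, |x|, y] := by
    rcases abs_choice x with h | h <;> rw [h]
    exacts [Reach.refl _ _, mv_f1 hL _ _ _ _ _]
  exact h1.trans (h2.trans (h3.trans h4))

lemma nrm_sort (hL : Good L) (a b c x y : ℤ) (ha : 0 ≤ a) (hb : 0 ≤ b) (hc : 0 ≤ c)
    (p1 : 2 ∣ a - b) (p2 : 2 ∣ b - c) :
    ∃ a' b' c' : ℤ, Reach L ![a, b, c, x, y] ![a', b', c', x, y] ∧ 0 ≤ c' ∧ c' ≤ b' ∧ b' ≤ a' ∧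
      2 ∣ a' - b' ∧ 2 ∣ b' - c' ∧ a' ^ 2 + b' ^ 2 + c' ^ 2 = a ^ 2 + b ^ 2 + c ^ 2 := by
  have r1 := fun a b c => mv_p12 hL a b c x y
  have r2 := fun a b c => mv_p23 hL a b c x y
  rcases le_total a b with h1 | h1 <;> rcases le_total b c with h2 | h2 <;>
    rcases le_total a c with h3 | h3
  · exact ⟨c, b, a, (r1 _ _ _).trans ((r2 _ _ _).trans (r1 _ _ _)), ha, h1, h2, by omega, by omega,
      by ring⟩
  · exact ⟨c, b, a, (r1 _ _ _).trans ((r2 _ _ _).trans (r1 _ _ _)), ha, h1, h2, by omega, by omega,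
      by ring⟩
  · exact ⟨b, c, a, (r1 _ _ _).trans (r2 _ _ _), ha, h3, h2, by omega, by omega, by ring⟩
  · exact ⟨b, a, c, r1 _ _ _, hc, h3, h1, by omega, by omega, by ring⟩
  · exact ⟨c, a, b, (r2 _ _ _).trans (r1 _ _ _), hb, h1, h3, by omega, by omega, by ring⟩
  · exact ⟨a, c, b, r2 _ _ _, hb, h2, h3, by omega, by omega, by ring⟩
  · exact ⟨a, b, c, Reach.refl _ _, hc, h2, h1, by omega, by omega, by ring⟩
  · exact ⟨a, b, c, Reach.refl _ _, hc, h2, h1, by omega, by omega, by ring⟩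

lemma nrm (hL : Good L) (a b c x y : ℤ) (p1 : 2 ∣ a - b) (p2 : 2 ∣ b - c) :
    ∃ a' b' c' : ℤ, Reach L ![a, b, c, x, y] ![a', b', c', |x|, y] ∧
      0 ≤ c' ∧ c' ≤ b' ∧ b' ≤ a' ∧
      2 ∣ a' - b' ∧ 2 ∣ b' - c' ∧ a' ^ 2 + b' ^ 2 + c' ^ 2 = a ^ 2 + b ^ 2 + c ^ 2 := by
  have e1 : 2 ∣ |a| - |b| := by
    rcases abs_choice a with h | h <;> rcases abs_choice b with h' | h' <;> rw [h, h'] <;> omega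
  have e2 : 2 ∣ |b| - |c| := by
    rcases abs_choice b with h | h <;> rcases abs_choice c with h' | h' <;> rw [h, h'] <;> omega
  obtain ⟨a', b', c', r, h⟩ := nrm_sort hL |a| |b| |c| |x| y (abs_nonneg a) (abs_nonneg b)
    (abs_nonneg c) e1 e2
  simp only [sq_abs] at h
  exact ⟨a', b', c', (nrm_abs hL a b c x y).trans r, h⟩

/-- Endgame arithmetic: the only small positive solution. -/
lemma endgame {a b c x y : ℤ} (h0 : 0 ≤ c) (h1 : c ≤ b) (h2 : b ≤ a) (hab : a + b ≤ x)
    (e : a ^ 2 + b ^ 2 + c ^ 2 + 1 = x ^ 2 + y ^ 2) (p1 : 2 ∣ a - b) (p2 : 2 ∣ b - c)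
    (hx : a < x) (hy : 0 ≤ y) :
    (a = 1 ∧ b = 1 ∧ c = 1 ∧ x = 2 ∧ y = 0) ∨ (a = 0 ∧ b = 0 ∧ c = 0 ∧ x = 1 ∧ y = 0) := by
  have k : 2 * (a * b) + y ^ 2 ≤ 1 + c ^ 2 := by nlinarith
  have k1 : c * c ≤ a * b := mul_le_mul (h1.trans h2) h1 h0 (by omega)
  have k2 : c ^ 2 ≤ 1 := by nlinarith [sq_nonneg y]
  have k3 : c ≤ 1 := by nlinarith
  have hc : c = 0 ∨ c = 1 := by omega
  rcases hc with rfl | rfl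
  · right
    have hb : b = 0 := by
      by_contra hb
      have : 1 ≤ b := by omega
      nlinarith [sq_nonneg y]
    subst hb
    have : (a + 1) ^ 2 ≤ x ^ 2 := by
      apply pow_le_pow_left₀ <;> omega
    have ha : a = 0 := by nlinarith [sq_nonneg y]
    subst ha
    have hx1 : x = 1 := by nlinarith [sq_nonneg y]
    subst hx1
    have : y = 0 := by nlinarith
    simp [this]
  · left
    have ha : a ≤ 1 := by nlinarith [sq_nonneg y]
    have ha : a = 1 := by omega
    have hb : b = 1 := by omega
    subst ha hb
    have hx1 : x = 2 := by nlinarith [sq_nonneg y]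
    subst hx1
    have : y = 0 := by nlinarith
    simp [this]

lemma red1 (hL : Good L) : ∀ n : ℕ, ∀ a b c x : ℤ, 2 ∣ a - b → 2 ∣ b - c →
    a ^ 2 + b ^ 2 + c ^ 2 + 1 = x ^ 2 → x ^ 2 < n →
    Reach L ![a, b, c, x, 0] ![0, 0, 0, 1, 0] := by
  intro n
  induction n with
  | zero => intro a b c x _ _ _ h; exact absurd h (by push_cast; nlinarith [sq_nonneg x])
  | succ n ih =>
    intro a b c x p1 p2 e hn
    obtain ⟨a', b', c', r, h0, h1, h2, q1, q2, e'⟩ := nrm hL a b c x 0 p1 p2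
    refine r.trans ?_
    have hx0 := abs_nonneg x
    rw [← sq_abs x] at e hn
    generalize |x| = z at *
    rw [← e'] at e
    clear e' r p1 p2 a b c x
    have hz : a' < z := by nlinarith [sq_nonneg b', sq_nonneg c']
    rcases lt_or_ge z (a' + b') with h | h
    · refine (mv_P hL _ _ _ _ _).trans (ih _ _ _ _ (by omega) (by omega) ?_ ?_)
      · linear_combination e
      · push_cast at hn
        have : (z - 2 * (a' + b' - z)) ^ 2 < z ^ 2 := by nlinarith
        linarith
    · rcases endgame (y := 0) h0 h1 h2 h (by rw [e]; ring) q1 q2 hz le_rfl with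
        ⟨rfl, rfl, rfl, rfl, _⟩ | ⟨rfl, rfl, rfl, rfl, _⟩
      · simpa using mv_t hL 1 1 1 2 0
      · exact Reach.refl _ _

lemma red2 (hL : Good L) (h9 : gG 9 ∈ L) (h11 : gG 11 ∈ L) (h16 : gG 16 ∈ L) :
    ∀ n : ℕ, ∀ a b c x y : ℤ, 2 ∣ a - b → 2 ∣ b - c →
    a ^ 2 + b ^ 2 + c ^ 2 + 1 = x ^ 2 + y ^ 2 → x ^ 2 + y ^ 2 < n →
    Reach L ![a, b, c, x, y] ![0, 0, 0, 0, 1] := by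
  intro n
  induction n with
  | zero =>
    intro a b c x y _ _ _ h
    exact absurd h (by push_cast; nlinarith [sq_nonneg x, sq_nonneg y])
  | succ n ih =>
    intro a b c x y p1 p2 e hn
    obtain ⟨a', b', c', r, h0, h1, h2, q1, q2, e'⟩ := nrm hL a b c x y p1 p2
    refine r.trans ?_
    rw [← e'] at e
    clear e' r p1 p2 a b c
    have r2 : Reach L ![a', b', c', |x|, y] ![a', b', c', |x|, |y|] := by
      rcases abs_choice y with h | h
      · rw [h]; exact Reach.refl _ _
      · conv => arg 3; rw [h]
        exact mv_f2 h11 _ _ _ _ _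
    refine r2.trans ?_
    clear r2
    have hx0 := abs_nonneg x
    have hy0 := abs_nonneg y
    rw [← sq_abs x, ← sq_abs y] at e hn
    generalize |x| = x at *
    generalize |y| = y at *
    obtain ⟨z, w, r3, hw, hwz, e3⟩ : ∃ z w : ℤ, Reach L ![a', b', c', x, y] ![a', b', c', z, w] ∧
        0 ≤ w ∧ w ≤ z ∧ z ^ 2 + w ^ 2 = x ^ 2 + y ^ 2 := by
      rcases le_total x y with h | h
      · exact ⟨y, x, mv_q h16 _ _ _ _ _, hx0, h, by ring⟩
      · exact ⟨x, y, Reach.refl _ _, hy0, h, by ring⟩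
    refine r3.trans ?_
    rw [← e3] at e hn
    clear e3 r3 hx0 hy0 x y
    push_cast at hn
    rcases lt_or_ge a' z with hz | hz
    · rcases lt_or_ge z (a' + b') with h | h
      · refine (mv_P hL _ _ _ _ _).trans (ih _ _ _ _ _ (by omega) (by omega) ?_ ?_)
        · linear_combination e
        · have : (z - 2 * (a' + b' - z)) ^ 2 < z ^ 2 := by nlinarith
          linarith
      · rcases endgame h0 h1 h2 h e q1 q2 hz hw with
          ⟨rfl, rfl, rfl, rfl, rfl⟩ | ⟨rfl, rfl, rfl, rfl, rfl⟩
        · have := mv_t hL 1 1 1 2 0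
          norm_num at this
          exact this.trans (mv_q h16 _ _ _ _ _)
        · exact mv_q h16 _ _ _ _ _
    · have hs : a' < z + w := by
        by_contra hcon
        have h3 : (z + w) ^ 2 ≤ a' ^ 2 := by
          apply pow_le_pow_left₀ <;> omega
        nlinarith [sq_nonneg b', sq_nonneg c', mul_nonneg (hw.trans hwz) hw]
      rcases lt_or_ge (z + w) (2 * a') with h | h
      · refine (mv_M h9 _ _ _ _ _).trans (ih _ _ _ _ _ (by omega) (by omega) ?_ ?_)
        · linear_combination e
        · have : (z + 2 * (a' - z - w)) ^ 2 + (w + 2 * (a' - z - w)) ^ 2 < z ^ 2 + w ^ 2 := by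
            nlinarith
          linarith
      · have hza : z = a' := by omega
        have hwa : w = a' := by omega
        subst hza hwa
        have hb : 1 ≤ b' := by
          by_contra hb
          have hb0 : b' = 0 := by omega
          have hc0 : c' = 0 := by omega
          subst hb0 hc0
          have : w ^ 2 = 1 := by linarith
          have : w ≤ 1 := by nlinarith
          have : w = 0 := by omega
          subst this
          omega
        refine (mv_P hL _ _ _ _ _).trans (ih _ _ _ _ _ (by omega) (by omega) ?_ ?_)
        · linear_combination e
        · have : (w - 2 * (w + b' - w)) ^ 2 < w ^ 2 := by nlinarith
          linarith

end moves

/-- A left inverse of `matT` up to the factor `2`. -/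
def matT' : Matrix (Fin 5) (Fin 5) ℤ :=
  !![-1, -2, 1, 2, 0; 2, -1, 1, 0, 2; 0, 0, 2, 0, 0; 1, 0, 1, 0, 0; 0, 1, 1, 0, 0]

lemma matT_inj {v w : Fin 5 → ℤ} (h : matT *ᵥ v = matT *ᵥ w) : v = w := by
  have e : matT' * matT = (2 : ℤ) • (1 : Matrix (Fin 5) (Fin 5) ℤ) := by decide +kernel
  have := congrArg (fun z => matT' *ᵥ z) h
  simp only [Matrix.mulVec_mulVec, e, Matrix.smul_mulVec, Matrix.one_mulVec] at this
  ext i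
  have := congrFun this i
  simp only [Pi.smul_apply, smul_eq_mul] at this
  omega

lemma matT_apply (v : Fin 5 → ℤ) : matT *ᵥ v =
    ![-v 2 + 2 * v 3, -v 2 + 2 * v 4, v 2, v 0 - 2 * v 2 + v 3 + 2 * v 4,
      v 1 - 2 * v 3 + v 4] := by
  ext i
  fin_cases i <;> simp [matT, Matrix.mulVec, dotProduct, Fin.sum_univ_five] <;> ring

/-- The bilinear form in coordinates. -/
lemma orth_col {g : GL (Fin 5) ℤ} (hg : g ∈ orthogonalSubgroup matQ) (i j : Fin 5) :
    (fun k => g.val k i) ⬝ᵥ (matQ *ᵥ fun k => g.val k j) = matQ i j := by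
  have h : g.valᵀ * matQ * g.val = matQ := hg
  conv_rhs => rw [← h]
  rw [Matrix.mul_assoc, Matrix.mul_apply]
  rfl

lemma col_mul (γ g : GL (Fin 5) ℤ) (j : Fin 5) :
    (fun k => (γ * g).val k j) = γ.val *ᵥ (fun k => g.val k j) := by
  ext k
  rw [Units.val_mul, Matrix.mul_apply]
  rfl

lemma form_apply (v w : Fin 5 → ℤ) : v ⬝ᵥ (matQ *ᵥ w) =
    (v 0 - 2 * v 2 + v 3 + 2 * v 4) * (w 0 - 2 * w 2 + w 3 + 2 * w 4)
    + (v 1 - 2 * v 3 + v 4) * (w 1 - 2 * w 3 + w 4)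
    - (-v 2 + 2 * v 3) * (-w 2 + 2 * w 3) - (-v 2 + 2 * v 4) * (-w 2 + 2 * w 4)
    - v 2 * w 2 := by
  simp [matQ, Matrix.mulVec, dotProduct, Fin.sum_univ_five]
  ring

/-- The subgroup of `gH 17` fixing the second basis vector. -/
def gK1 : Subgroup (GL (Fin 5) ℤ) where
  carrier := {γ | γ ∈ gH 17 ∧ γ.val *ᵥ ![0, 1, 0, 0, 0] = ![0, 1, 0, 0, 0]}
  one_mem' := ⟨one_mem _, by simp⟩
  mul_mem' := by
    rintro a b ⟨ha, ha'⟩ ⟨hb, hb'⟩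
    refine ⟨mul_mem ha hb, ?_⟩
    rw [Units.val_mul, ← Matrix.mulVec_mulVec, hb', ha']
  inv_mem' := by
    rintro a ⟨ha, ha'⟩
    refine ⟨inv_mem ha, ?_⟩
    conv_lhs => rw [← ha']
    rw [Matrix.mulVec_mulVec, Units.inv_mul, Matrix.one_mulVec]

lemma good_H : Good (gH 17) := fun i _ => gG_mem i.2

lemma good_K1 : Good gK1 := by
  intro i hi
  refine ⟨gG_mem i.2, ?_⟩
  rw [gG_val]
  revert i
  decide +kernel

lemma move_col1 (g : GL (Fin 5) ℤ) (hg : g ∈ orthogonalSubgroup matQ) :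
    ∃ γ ∈ gH 17, (fun k => (γ * g).val k 1) = ![0, 1, 0, 0, 0] := by
  have h := orth_col hg 1 1
  rw [form_apply] at h
  have hq : matQ 1 1 = 1 := rfl
  rw [hq] at h
  set v : Fin 5 → ℤ := fun k => g.val k 1 with hv
  have hr := red2 good_H (gG_mem (by decide)) (gG_mem (by decide)) (gG_mem (by decide))
    (((v 0 - 2 * v 2 + v 3 + 2 * v 4) ^ 2 + (v 1 - 2 * v 3 + v 4) ^ 2).toNat + 1)
    (-v 2 + 2 * v 3) (-v 2 + 2 * v 4) (v 2) (v 0 - 2 * v 2 + v 3 + 2 * v 4)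
    (v 1 - 2 * v 3 + v 4) (by omega) (by omega) (by linear_combination -h) (by
      push_cast
      rw [Int.toNat_of_nonneg (by positivity)]
      omega)
  obtain ⟨γ, hγ, hh⟩ := hr
  refine ⟨γ, hγ, ?_⟩
  rw [col_mul]
  apply matT_inj
  rw [hh v (matT_apply v)]
  decide +kernel

lemma move_col0 (g : GL (Fin 5) ℤ) (hg : g ∈ orthogonalSubgroup matQ)
    (h1 : (fun k => g.val k 1) = ![0, 1, 0, 0, 0]) :
    ∃ γ ∈ gK1, (fun k => (γ * g).val k 0) = ![1, 0, 0, 0, 0] := by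
  have h := orth_col hg 0 0
  have h' := orth_col hg 0 1
  rw [h1] at h'
  rw [form_apply] at h h'
  have hq : matQ 0 0 = 1 := rfl
  have hq' : matQ 0 1 = 0 := rfl
  rw [hq] at h
  rw [hq'] at h'
  set v : Fin 5 → ℤ := fun k => g.val k 0 with hv
  have hy : v 1 - 2 * v 3 + v 4 = 0 := by
    simpa using h'
  have hr := red1 good_K1
    (((v 0 - 2 * v 2 + v 3 + 2 * v 4) ^ 2).toNat + 1)
    (-v 2 + 2 * v 3) (-v 2 + 2 * v 4) (v 2) (v 0 - 2 * v 2 + v 3 + 2 * v 4)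
    (by omega) (by omega) (by rw [hy] at h; linear_combination -h) (by
      push_cast
      rw [Int.toNat_of_nonneg (by positivity)]
      omega)
  obtain ⟨γ, hγ, hh⟩ := hr
  refine ⟨γ, hγ, ?_⟩
  rw [col_mul]
  apply matT_inj
  rw [hh v (by rw [matT_apply v, hy])]
  decide +kernel

lemma bound_col (v : Fin 5 → ℤ) (x y : ℤ) (hx : |x| ≤ 2) (hy : |y| ≤ 2)
    (hxy : x ^ 2 + y ^ 2 ≤ 5)
    (h0 : v 0 - 2 * v 2 + v 3 + 2 * v 4 = x) (h1 : v 1 - 2 * v 3 + v 4 = y)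
    (h2 : x * x + y * y - (-v 2 + 2 * v 3) * (-v 2 + 2 * v 3)
      - (-v 2 + 2 * v 4) * (-v 2 + 2 * v 4) - v 2 * v 2 = 1) (k : Fin 5) : |v k| ≤ 20 := by
  have aux : ∀ z : ℤ, z * z ≤ 4 → -2 ≤ z ∧ z ≤ 2 := by
    intro z hz
    constructor <;> nlinarith
  have a1 := aux (v 2) (by nlinarith [sq_nonneg (-v 2 + 2 * v 3), sq_nonneg (-v 2 + 2 * v 4)])
  have a2 := aux (-v 2 + 2 * v 3) (by nlinarith [sq_nonneg (v 2), sq_nonneg (-v 2 + 2 * v 4)])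
  have a3 := aux (-v 2 + 2 * v 4) (by nlinarith [sq_nonneg (-v 2 + 2 * v 3), sq_nonneg (v 2)])
  rw [abs_le] at hx hy
  have b0 : |v 0| ≤ 20 := by rw [abs_le]; omega
  have b1 : |v 1| ≤ 20 := by rw [abs_le]; omega
  have b2 : |v 2| ≤ 20 := by rw [abs_le]; omega
  have b3 : |v 3| ≤ 20 := by rw [abs_le]; omega
  have b4 : |v 4| ≤ 20 := by rw [abs_le]; omega
  fin_cases k
  exacts [b0, b1, b2, b3, b4]

lemma bound_all (h : GL (Fin 5) ℤ) (hh : h ∈ orthogonalSubgroup matQ)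
    (h0 : (fun k => h.val k 0) = ![1, 0, 0, 0, 0])
    (h1 : (fun k => h.val k 1) = ![0, 1, 0, 0, 0]) (i j : Fin 5) : |h.val i j| ≤ 20 := by
  have e0 := orth_col hh 0 j
  have e1 := orth_col hh 1 j
  have e2 := orth_col hh j j
  rw [h0, form_apply] at e0
  rw [h1, form_apply] at e1
  rw [form_apply] at e2
  have c1 : matQ j j = 1 := by clear e0 e1 e2; revert j; decide +kernel
  have c2 : |matQ 0 j| ≤ 2 ∧ |matQ 1 j| ≤ 2 ∧ matQ 0 j ^ 2 + matQ 1 j ^ 2 ≤ 5 := by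
    clear e0 e1 e2 c1
    revert j; decide +kernel
  simp at e0 e1
  refine bound_col (fun k => h.val k j) (matQ 0 j) (matQ 1 j) c2.1 c2.2.1 c2.2.2 e0 e1 ?_ i
  rw [← e0, ← e1, ← c1]
  exact e2

lemma finite_bdd : {h : GL (Fin 5) ℤ | ∀ i j, |h.val i j| ≤ 20}.Finite := by
  have hf : (Set.pi Set.univ fun _ : Fin 5 => Set.pi Set.univ fun _ : Fin 5 =>
      Set.Icc (-20 : ℤ) 20).Finite :=
    Set.Finite.pi fun _ => Set.Finite.pi fun _ => Set.finite_Icc _ _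
  refine Set.Finite.of_finite_image (f := fun h : GL (Fin 5) ℤ => fun i j => h.val i j)
    (hf.subset ?_) ?_
  · rintro _ ⟨h, hh, rfl⟩ i _ j _
    exact abs_le.1 (hh i j)
  · intro a _ b _ hab
    apply Units.ext
    ext i j
    exact congrFun (congrFun hab i) j

lemma FC_orth : FC (gH 17) (orthogonalSubgroup matQ) := by
  refine ⟨(fun h => h⁻¹) '' {h : GL (Fin 5) ℤ | ∀ i j, |h.val i j| ≤ 20},
    finite_bdd.image _, ?_⟩
  intro g hg
  have hg' := inv_mem hg
  obtain ⟨γ, hγ, h1⟩ := move_col1 _ hg'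
  have m1 := mul_mem (gH17_le hγ) hg'
  obtain ⟨δ, hδ, h0⟩ := move_col0 _ m1 h1
  have m2 := mul_mem (gH17_le hδ.1) m1
  refine ⟨(δ * (γ * g⁻¹))⁻¹, ⟨δ * (γ * g⁻¹), ?_, rfl⟩, δ * γ, mul_mem hδ.1 hγ, by group⟩
  refine bound_all _ m2 h0 ?_
  rw [col_mul, h1]
  exact hδ.2

/-- Case 6 of Theorem 1.2: the hypergeometric group `Γ(f,g)` generated by the companion matrices `A`, `B`
of `f(x) = x^5 + x^4 + x^3 - x^2 - x - 1` and `g(x) = x^5 + x^3 + x^2 + 1`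
is an arithmetic subgroup of `O_Q(ℤ)`: it preserves `Q`, it is contained in `O_Q(ℤ)`,
and it has finite index in `O_Q(ℤ)`. -/
theorem hypergeometric_group_arithmetic
    (A B : GL (Fin 5) ℤ)
    (hA : (A : Matrix (Fin 5) (Fin 5) ℤ) = matA)
    (hB : (B : Matrix (Fin 5) (Fin 5) ℤ) = matB) :
    matAᵀ * matQ * matA = matQ ∧
    matBᵀ * matQ * matB = matQ ∧
    Subgroup.closure {A, B} ≤ orthogonalSubgroup matQ ∧
    ((Subgroup.closure {A, B}).subgroupOf (orthogonalSubgroup matQ)).FiniteIndex := by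
  have hA' : matAᵀ * matQ * matA = matQ := by decide +kernel
  have hB' : matBᵀ * matQ * matB = matQ := by decide +kernel
  refine ⟨hA', hB', ?_, ?_⟩
  · rw [Subgroup.closure_le]
    rintro x (rfl | rfl)
    · change (x.val)ᵀ * matQ * x.val = matQ
      rw [hA, hA']
    · change (x.val)ᵀ * matQ * x.val = matQ
      rw [hB, hB']
  · exact ((gH_FC.mono (gH6_le A B hA hB)).trans FC_orth).finiteIndex
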